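/- Let K be a finite simple graph that is connected and co-connected (its complement graph is connected), contains no induced cycle of length at least 5, and contains no induced subgraph isomorphic to P₁(6) or P₂(6). Then for every two vertices u, v at distance 2 in K and every co-component W of C({u,v}), at least one of the following holds: (1) removing {u} ∪ W from K leaves a disconnected graph; (2) removing {v} ∪ W from K leaves a disconnected graph; (3) the set W' = C(W) ∖ {u,v} is nonempty and W ∪ W' separates u from v. -/

import Mathlib

/-- `P₁(6)`: the complement of the `6`-cycle, i.e. the triangular prism. -/
def P16 : SimpleGraph (Fin 6) := (SimpleGraph.cycleGraph 6)ᶜ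

/-- `P₂(6)`: the complement of the path graph on six vertices. -/
def P26 : SimpleGraph (Fin 6) := (SimpleGraph.pathGraph 6)ᶜ

/-- The set of common neighbours of a set `S` of vertices. -/
def commonNbrs {V : Type*} (K : SimpleGraph V) (S : Set V) : Set V :=
  {x | ∀ s ∈ S, K.Adj x s}

/-- `U` is a co-component of `W`: the (image in `V` of the) vertex set of a connected
component of the complement of the induced subgraph of `K` on `W`. -/
def IsCoComponent {V : Type*} (K : SimpleGraph V) (W U : Set V) : Prop :=
  ∃ c : ((Kᶜ).induce W).ConnectedComponent, U = Subtype.val '' c.supp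

/-- The set `L` separates `u` from `v` in `K`: neither lies in `L`, and they are in
distinct connected components of the induced subgraph on the complement of `L`. -/
def SeparatesIn {V : Type*} (K : SimpleGraph V) (L : Set V) (u v : V) : Prop :=
  ∃ (hu : u ∈ Lᶜ) (hv : v ∈ Lᶜ), ¬ (K.induce Lᶜ).Reachable ⟨u, hu⟩ ⟨v, hv⟩

/-- `u` and `v` are at distance 2: distinct, non-adjacent, with a common neighbour. -/
def AtDistanceTwo {V : Type*} (K : SimpleGraph V) (u v : V) : Prop :=
  u ≠ v ∧ ¬ K.Adj u v ∧ ∃ w, K.Adj u w ∧ K.Adj w v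

open SimpleGraph

/-- The vertices `f 0, …, f (n - 1)` form, in this order, an induced cycle of length `n`. -/
def IsInducedCycleSeq {V : Type*} (G : SimpleGraph V) (n : ℕ) (f : ℕ → V) : Prop :=
  ∀ i j, i < j → j < n → f i ≠ f j ∧ (G.Adj (f i) (f j) ↔ j = i + 1 ∨ (i = 0 ∧ j + 1 = n))

/-- The vertices `f 0, …, f m` form, in this order, an induced path of length `m`. -/
def IsInducedPathSeq {V : Type*} (G : SimpleGraph V) (m : ℕ) (f : ℕ → V) : Prop :=
  ∀ i j, i < j → j ≤ m → f i ≠ f j ∧ (G.Adj (f i) (f j) ↔ j = i + 1)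

/-- A sequence of vertices whose adjacencies at increasing indices agree with those of a graph
on `Fin n` gives an induced copy of that graph. -/
theorem nonempty_embedding_of_seq {V : Type*} {G : SimpleGraph V} {n : ℕ}
    {H : SimpleGraph (Fin n)} {f : ℕ → V}
    (hf : ∀ i j : Fin n, i < j → f i ≠ f j ∧ (G.Adj (f i) (f j) ↔ H.Adj i j)) :
    Nonempty (H ↪g G) := by
  refine ⟨⟨⟨fun i => f i, fun i j hij => ?_⟩, fun {i j} => ?_⟩⟩
  · rcases lt_trichotomy i j with h | h | h
    · exact absurd hij (hf i j h).1
    · exact h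
    · exact absurd hij.symm (hf j i h).1
  · change G.Adj (f i) (f j) ↔ H.Adj i j
    rcases lt_trichotomy i j with h | h | h
    · exact (hf i j h).2
    · subst h; simp
    · rw [G.adj_comm, H.adj_comm]; exact (hf j i h).2

theorem cycleGraph_adj_of_lt {n : ℕ} {i j : Fin n} (h : i < j) :
    (cycleGraph n).Adj i j ↔ (j : ℕ) = i + 1 ∨ ((i : ℕ) = 0 ∧ (j : ℕ) + 1 = n) := by
  have hi := i.isLt
  have hj := j.isLt
  have hlt : (i : ℕ) < j := h
  rw [cycleGraph_adj', Fin.coe_sub_iff_lt.2 h, Fin.coe_sub_iff_le.2 h.le]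
  omega

theorem IsInducedCycleSeq.nonempty_embedding {V : Type*} {G : SimpleGraph V} {n : ℕ} {f : ℕ → V}
    (hf : IsInducedCycleSeq G n f) : Nonempty (cycleGraph n ↪g G) :=
  nonempty_embedding_of_seq fun i j h =>
    ⟨(hf i j h j.isLt).1, (hf i j h j.isLt).2.trans (cycleGraph_adj_of_lt h).symm⟩

theorem IsInducedPathSeq.nonempty_embedding {V : Type*} {G : SimpleGraph V} {m : ℕ} {f : ℕ → V}
    (hf : IsInducedPathSeq G m f) : Nonempty (pathGraph (m + 1) ↪g G) :=
  nonempty_embedding_of_seq fun i j h => by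
    have hlt : (i : ℕ) < j := h
    obtain ⟨hne, hadj⟩ := hf i j h (Nat.lt_succ_iff.1 j.isLt)
    refine ⟨hne, hadj.trans ?_⟩
    rw [pathGraph_adj]
    omega

/-- An induced path is closed to an induced cycle by a vertex adjacent to exactly its ends. -/
theorem IsInducedPathSeq.isInducedCycleSeq {V : Type*} {G : SimpleGraph V} {m : ℕ} {f : ℕ → V}
    (hf : IsInducedPathSeq G m f) {c : V} (hne : ∀ i ≤ m, f i ≠ c)
    (hadj : ∀ i ≤ m, G.Adj (f i) c ↔ i = 0 ∨ i = m) :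
    IsInducedCycleSeq G (m + 2) (fun i => if i ≤ m then f i else c) := by
  intro i j hij hj
  have hi : i ≤ m := by omega
  by_cases hjm : j ≤ m
  · simp only [hi, hjm, if_true]
    refine ⟨(hf i j hij hjm).1, (hf i j hij hjm).2.trans ?_⟩
    omega
  · simp only [hi, hjm, if_true, if_false]
    refine ⟨hne i hi, (hadj i hi).trans ?_⟩
    omega

/-- An induced path is extended by a vertex adjacent to exactly its last vertex. -/
theorem IsInducedPathSeq.extend {V : Type*} {G : SimpleGraph V} {m : ℕ} {f : ℕ → V}
    (hf : IsInducedPathSeq G m f) {c : V} (hne : ∀ i ≤ m, f i ≠ c)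
    (hadj : ∀ i ≤ m, G.Adj (f i) c ↔ i = m) :
    IsInducedPathSeq G (m + 1) (fun i => if i ≤ m then f i else c) := by
  intro i j hij hj
  have hi : i ≤ m := by omega
  by_cases hjm : j ≤ m
  · simp only [hi, hjm, if_true]
    exact hf i j hij hjm
  · simp only [hi, hjm, if_true, if_false]
    refine ⟨hne i hi, (hadj i hi).trans ?_⟩
    omega

/-- Reachable vertices of an induced subgraph are joined by an induced path inside it. -/
theorem exists_isInducedPathSeq {V : Type*} {G : SimpleGraph V} {S : Set V} {a b : S}
    (h : (G.induce S).Reachable a b) :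
    ∃ (m : ℕ) (f : ℕ → V), f 0 = a ∧ f m = b ∧ (∀ i, f i ∈ S) ∧ IsInducedPathSeq G m f := by
  obtain ⟨p, hp⟩ := h.exists_walk_length_eq_dist
  have hdist : ∀ i ≤ p.length, (G.induce S).dist a (p.getVert i) = i := by
    intro i hi
    have h1 : (G.induce S).dist a (p.getVert i) ≤ i := by
      simpa [hi] using dist_le (p.take i)
    have h2 : (G.induce S).dist (p.getVert i) b ≤ p.length - i := by
      simpa using dist_le (p.drop i)
    have h3 := (p.take i).reachable.dist_triangle_left b
    omega
  refine ⟨p.length, fun i => p.getVert i, by simp, by simp, fun i => (p.getVert i).2, ?_⟩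
  intro i j hij hj
  have hi := hdist i (by omega)
  have hj' := hdist j hj
  refine ⟨fun he => ?_, fun hadj => ?_, ?_⟩
  · rw [Subtype.ext he] at hi
    omega
  · have hadj' : (G.induce S).Adj (p.getVert i) (p.getVert j) := hadj
    have := hadj'.diff_dist_adj (u := a)
    omega
  · rintro rfl
    exact p.adj_getVert_succ (by omega)

/-- In a graph without induced `C₅`, `P₁(6)`, `P₂(6)` the complement has no induced cycle of
length at least `5`. -/
theorem not_isInducedCycleSeq_compl {V : Type*} {K : SimpleGraph V}
    (hC5 : IsEmpty (cycleGraph 5 ↪g K)) (hP1 : IsEmpty (P16 ↪g K)) (hP2 : IsEmpty (P26 ↪g K))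
    {n : ℕ} (hn : 5 ≤ n) (f : ℕ → V) : ¬ IsInducedCycleSeq Kᶜ n f := by
  intro hf
  obtain rfl | rfl | hn7 : n = 5 ∨ n = 6 ∨ 7 ≤ n := by omega
  · have hadj : ∀ i j, i < j → j < 5 →
        f i ≠ f j ∧ (K.Adj (f i) (f j) ↔ ¬ (j = i + 1 ∨ (i = 0 ∧ j + 1 = 5))) := by
      intro i j hij hj
      obtain ⟨h1, h2⟩ := hf i j hij hj
      refine ⟨h1, ?_⟩
      rw [← h2, compl_adj]
      tauto
    have hg : IsInducedCycleSeq K 5 (fun i => f (2 * i % 5)) := by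
      intro i j hij hj
      rcases lt_or_ge (2 * i % 5) (2 * j % 5) with h | h
      · refine ⟨(hadj _ _ h (Nat.mod_lt _ (by omega))).1,
          (hadj _ _ h (Nat.mod_lt _ (by omega))).2.trans ?_⟩
        interval_cases j <;> interval_cases i <;> omega
      · have h' : 2 * j % 5 < 2 * i % 5 := by omega
        refine ⟨(hadj _ _ h' (Nat.mod_lt _ (by omega))).1.symm, ?_⟩
        rw [K.adj_comm]
        refine (hadj _ _ h' (Nat.mod_lt _ (by omega))).2.trans ?_
        interval_cases j <;> interval_cases i <;> omega
    exact hg.nonempty_embedding.elim hC5.elim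
  · obtain ⟨e⟩ := hf.nonempty_embedding
    exact hP1.elim (by simpa [P16] using Embedding.complEquiv e)
  · have hp : IsInducedPathSeq Kᶜ 5 f := by
      intro i j hij hj
      refine ⟨(hf i j hij (by omega)).1, (hf i j hij (by omega)).2.trans ?_⟩
      omega
    obtain ⟨e⟩ := hp.nonempty_embedding
    exact hP2.elim (by simpa [P26] using Embedding.complEquiv e)

/-- If removing `{u} ∪ W` and removing `{v} ∪ W` leaves connected graphs, but `W` separates the
vertices `u` and `v`, to which it is complete, then the complement graph is disconnected. -/
theorem not_separatesIn_of_connected {V : Type*} {K : SimpleGraph V} (hcoconn : Kᶜ.Connected)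
    {u v : V} {W : Set V} (hWne : W.Nonempty) (hWu : ∀ w ∈ W, K.Adj w u)
    (hWv : ∀ w ∈ W, K.Adj w v) (hu : (K.induce ({u} ∪ W)ᶜ).Connected)
    (hv : (K.induce ({v} ∪ W)ᶜ).Connected) : ¬ SeparatesIn K W u v := by
  rintro ⟨huW, hvW, hsep⟩
  by_cases huv : u = v
  · subst huv
    exact hsep (Reachable.refl _)
  by_cases hz : ∃ z, z ∉ W ∧ z ≠ u ∧ z ≠ v
  · obtain ⟨z, hzW, hzu, hzv⟩ := hz
    have h1 := hu.preconnected ⟨z, by simp [hzW, hzu]⟩ ⟨v, by simpa [Ne.symm huv] using hvW⟩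
    have h2 := hv.preconnected ⟨z, by simp [hzW, hzv]⟩ ⟨u, by simpa [huv] using huW⟩
    have hsub : ∀ t : V, ({t} ∪ W)ᶜ ⊆ Wᶜ := fun t =>
      Set.compl_subset_compl.2 Set.subset_union_right
    have h1' := h1.map (induceHomOfLE K (hsub u)).toHom
    have h2' := h2.map (induceHomOfLE K (hsub v)).toHom
    exact hsep (h2'.symm.trans h1')
  · push Not at hz
    have hstay : ∀ a b : V, Kᶜ.Reachable a b → a ∉ W → b ∉ W := by
      rintro a b ⟨p⟩
      induction p with
      | nil => exact id
      | cons h p ih =>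
        intro ha
        refine ih fun hb => ?_
        rename_i x y _
        by_cases hxu : x = u
        · exact ((compl_adj _ _ _).1 h).2 (hxu ▸ (hWu _ hb).symm)
        · exact ((compl_adj _ _ _).1 h).2 (hz _ ha hxu ▸ (hWv _ hb).symm)
    obtain ⟨w, hw⟩ := hWne
    exact hstay u w (hcoconn.preconnected u w) huW hw

/-- If `W` is connected in `G` and both `x` and `y` have neighbours in `W`, then some induced
path of `G` joins `x` to `y` with interior in `W`. -/
theorem exists_isInducedPathSeq_through {V : Type*} {G : SimpleGraph V} {W : Set V}
    (hW : (G.induce W).Preconnected) {x y a b : V} (ha : a ∈ W) (hb : b ∈ W)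
    (hxa : G.Adj x a) (hyb : G.Adj y b) :
    ∃ (m : ℕ) (f : ℕ → V), f 0 = x ∧ f m = y ∧ (∀ i, 0 < i → i < m → f i ∈ W) ∧
      IsInducedPathSeq G m f := by
  have hsub : W ⊆ W ∪ {x, y} := Set.subset_union_left
  have hxS : x ∈ W ∪ {x, y} := by simp
  have hyS : y ∈ W ∪ {x, y} := by simp
  have h1 : (G.induce (W ∪ {x, y})).Reachable ⟨x, hxS⟩ ⟨a, hsub ha⟩ :=
    Adj.reachable (G := G.induce (W ∪ {x, y})) hxa
  have h2 : (G.induce (W ∪ {x, y})).Reachable ⟨y, hyS⟩ ⟨b, hsub hb⟩ :=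
    Adj.reachable (G := G.induce (W ∪ {x, y})) hyb
  have h3 := (hW ⟨a, ha⟩ ⟨b, hb⟩).map (induceHomOfLE G hsub).toHom
  obtain ⟨m, f, h0, hm, hS, hf⟩ := exists_isInducedPathSeq (h1.trans (h3.trans h2.symm))
  refine ⟨m, f, h0, hm, fun i hi him => ?_, hf⟩
  rcases hS i with h | h | h
  · exact h
  · exact absurd (h0.trans h.symm) (hf 0 i hi him.le).1
  · exact absurd (h.trans hm.symm) (hf i m him le_rfl).1

/-- A co-component is connected in the complement graph. -/
theorem IsCoComponent.preconnected {V : Type*} {K : SimpleGraph V} {N W : Set V}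
    (h : IsCoComponent K N W) : (Kᶜ.induce W).Preconnected := by
  obtain ⟨c, rfl⟩ := h
  rintro ⟨_, a, ha, rfl⟩ ⟨_, b, hb, rfl⟩
  let φ : c.toSimpleGraph →g Kᶜ.induce (Subtype.val '' c.supp) :=
    ⟨fun z => ⟨z.1.1, z.1, z.2, rfl⟩, fun {_ _} h => h⟩
  exact (c.connected_toSimpleGraph.preconnected ⟨a, ha⟩ ⟨b, hb⟩).map φ

theorem IsCoComponent.subset {V : Type*} {K : SimpleGraph V} {N W : Set V}
    (h : IsCoComponent K N W) : W ⊆ N := by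
  obtain ⟨c, rfl⟩ := h
  rintro _ ⟨a, -, rfl⟩
  exact a.2

theorem IsCoComponent.nonempty {V : Type*} {K : SimpleGraph V} {N W : Set V}
    (h : IsCoComponent K N W) : W.Nonempty := by
  obtain ⟨c, rfl⟩ := h
  exact c.nonempty_supp.image _

/-- A co-component is complete to the rest of the vertex set. -/
theorem IsCoComponent.adj {V : Type*} {K : SimpleGraph V} {N W : Set V}
    (h : IsCoComponent K N W) {x w : V} (hx : x ∈ N) (hxW : x ∉ W) (hw : w ∈ W) :
    K.Adj x w := by
  obtain ⟨c, rfl⟩ := h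
  obtain ⟨b, hb, rfl⟩ := hw
  by_contra hadj
  have hne : x ≠ b := fun he => hxW ⟨b, hb, he.symm⟩
  have hadj' : (Kᶜ.induce N).Adj ⟨x, hx⟩ b := (compl_adj _ _ _).2 ⟨hne, hadj⟩
  refine hxW ⟨⟨x, hx⟩, ?_, rfl⟩
  rw [ConnectedComponent.mem_supp_iff] at hb ⊢
  rw [← hb]
  exact ConnectedComponent.sound hadj'.reachable

/-- In a graph without long holes, a vertex adjacent to both ends of an induced path of length
at least `3` is adjacent to its second or its third vertex. -/
theorem adj_one_or_adj_two {V : Type*} {K : SimpleGraph V}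
    (hholes : ∀ n : ℕ, 5 ≤ n → IsEmpty (cycleGraph n ↪g K)) {m : ℕ} {p : ℕ → V}
    (hp : IsInducedPathSeq K m p) (hm : 3 ≤ m) {w : V} (hw0 : K.Adj (p 0) w)
    (hwm : K.Adj (p m) w) (hne : ∀ i ≤ m, p i ≠ w) : K.Adj (p 1) w ∨ K.Adj (p 2) w := by
  classical
  by_contra! h
  have hex : ∃ j, 0 < j ∧ K.Adj (p j) w := ⟨m, by omega, hwm⟩
  obtain ⟨hj0, hjw⟩ := Nat.find_spec hex
  have hjm : Nat.find hex ≤ m := Nat.find_min' hex ⟨by omega, hwm⟩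
  have hmin : ∀ i < Nat.find hex, ¬ (0 < i ∧ K.Adj (p i) w) := fun i hi => Nat.find_min hex hi
  generalize Nat.find hex = j at *
  have hj3 : 3 ≤ j := by
    by_contra! hlt
    obtain rfl | rfl : j = 1 ∨ j = 2 := by omega
    · exact h.1 hjw
    · exact h.2 hjw
  have hpj : IsInducedPathSeq K j p := fun i k hik hk => hp i k hik (hk.trans hjm)
  have hcyc := hpj.isInducedCycleSeq (c := w) (fun i hi => hne i (hi.trans hjm)) fun i hi => by
    constructor
    · intro hadj
      by_contra! hcon
      exact hmin i (by omega) ⟨by omega, hadj⟩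
    · rintro (rfl | rfl) <;> assumption
  exact hcyc.nonempty_embedding.elim (hholes (j + 2) (by omega)).elim

/-- In a graph with no long holes, `P₁(6)` or `P₂(6)`, let `W` be co-connected and complete to
the ends of an induced path of length at least `3` avoiding `W`. Then the second or the third
vertex of the path is complete to `W`. -/
theorem complete_one_or_complete_two {V : Type*} {K : SimpleGraph V}
    (hholes : ∀ n : ℕ, 5 ≤ n → IsEmpty (cycleGraph n ↪g K))
    (hP1 : IsEmpty (P16 ↪g K)) (hP2 : IsEmpty (P26 ↪g K)) {W : Set V}
    (hW : (Kᶜ.induce W).Preconnected) {m : ℕ} {p : ℕ → V} (hp : IsInducedPathSeq K m p)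
    (hm : 3 ≤ m) (hpW : ∀ i, p i ∉ W) (h0 : ∀ w ∈ W, K.Adj w (p 0))
    (hmW : ∀ w ∈ W, K.Adj w (p m)) :
    p 1 ∈ commonNbrs K W ∨ p 2 ∈ commonNbrs K W := by
  by_contra! h
  simp only [commonNbrs, Set.mem_ofPred_eq, not_forall] at h
  obtain ⟨⟨a, haW, ha⟩, b, hbW, hb⟩ := h
  have hpne : ∀ i, ∀ w ∈ W, p i ≠ w := fun i w hw he => hpW i (he ▸ hw)
  have h12 : K.Adj (p 1) (p 2) := (hp 1 2 (by omega) (by omega)).2.2 rfl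
  obtain ⟨k, q, hq0, hqk, hqW, hq⟩ := exists_isInducedPathSeq_through hW haW hbW
    ((compl_adj _ _ _).2 ⟨hpne 1 a haW, ha⟩) ((compl_adj _ _ _).2 ⟨hpne 2 b hbW, hb⟩)
  have hk3 : 3 ≤ k := by
    by_contra! hlt
    obtain rfl | rfl | rfl : k = 0 ∨ k = 1 ∨ k = 2 := by omega
    · exact h12.ne (hq0.symm.trans hqk)
    · have := (hq 0 1 (by omega) le_rfl).2.2 rfl
      rw [hq0, hqk] at this
      exact ((compl_adj _ _ _).1 this).2 h12
    · have h1 := (hq 0 1 (by omega) (by omega)).2.2 rfl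
      have h2 := (hq 1 2 (by omega) le_rfl).2.2 rfl
      have hw := hqW 1 (by omega) (by omega)
      rw [hq0, compl_adj] at h1
      rw [hqk, Kᶜ.adj_comm, compl_adj] at h2
      exact (adj_one_or_adj_two hholes hp hm (h0 _ hw).symm (hmW _ hw).symm
        fun i _ => hpne i _ hw).elim h1.2 h2.2
  have hq_cases : ∀ i ≤ k, i = 0 ∧ q i = p 1 ∨ i = k ∧ q i = p 2 ∨
      (0 < i ∧ i < k) ∧ q i ∈ W := by
    intro i hi
    obtain rfl | rfl | hi' : i = 0 ∨ i = k ∨ (0 < i ∧ i < k) := by omega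
    · exact Or.inl ⟨rfl, hq0⟩
    · exact Or.inr (Or.inl ⟨rfl, hqk⟩)
    · exact Or.inr (Or.inr ⟨hi', hqW i hi'.1 hi'.2⟩)
  have h1m := hp 1 m (by omega) le_rfl
  have h2m := hp 2 m (by omega) le_rfl
  have h0m := hp 0 m (by omega) le_rfl
  have h01 := hp 0 1 (by omega) (by omega)
  have h02 := hp 0 2 (by omega) (by omega)
  have hqm : ∀ i ≤ k, q i ≠ p m := by
    intro i hi
    rcases hq_cases i hi with ⟨-, h⟩ | ⟨-, h⟩ | ⟨-, h⟩
    · rw [h]; exact h1m.1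
    · rw [h]; exact h2m.1
    · exact (hpne m _ h).symm
  have hC5 := hholes 5 le_rfl
  rcases hm.lt_or_eq with hm4 | rfl
  · refine not_isInducedCycleSeq_compl hC5 hP1 hP2 (n := k + 2) (by omega) _
      (hq.isInducedCycleSeq (c := p m) hqm fun i hi => ?_)
    rw [compl_adj]
    rcases hq_cases i hi with ⟨hi, h⟩ | ⟨hi, h⟩ | ⟨hi, h⟩
    · rw [h, h1m.2]
      exact ⟨fun _ => Or.inl hi, fun _ => ⟨h1m.1, by omega⟩⟩
    · rw [h, h2m.2]
      exact ⟨fun _ => Or.inr hi, fun _ => ⟨h2m.1, by omega⟩⟩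
    · have := hmW _ h
      exact ⟨fun h' => absurd this h'.2, fun h' => by omega⟩
  · have hqe : IsInducedPathSeq Kᶜ (k + 1) (fun i => if i ≤ k then q i else p 0) := by
      refine hq.extend (fun i hi => ?_) fun i hi => ?_
      · rcases hq_cases i hi with ⟨-, h⟩ | ⟨-, h⟩ | ⟨-, h⟩
        · rw [h]; exact h01.1.symm
        · rw [h]; exact h02.1.symm
        · exact (hpne 0 _ h).symm
      · rw [compl_adj]
        rcases hq_cases i hi with ⟨hi, h⟩ | ⟨hi, h⟩ | ⟨hi, h⟩
        · rw [h, K.adj_comm, h01.2]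
          exact ⟨fun h' => absurd rfl h'.2, fun h' => by omega⟩
        · rw [h, K.adj_comm, h02.2]
          exact ⟨fun _ => hi, fun _ => ⟨h02.1.symm, by omega⟩⟩
        · have := h0 _ h
          exact ⟨fun h' => absurd this h'.2, fun h' => by omega⟩
    refine not_isInducedCycleSeq_compl hC5 hP1 hP2 (n := k + 1 + 2) (by omega) _
      (hqe.isInducedCycleSeq (c := p 3) (fun i hi => ?_) fun i hi => ?_)
    · by_cases hik : i ≤ k
      · simp only [hik, if_true]
        exact hqm i hik
      · simp only [hik, if_false]
        exact h0m.1
    · by_cases hik : i ≤ k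
      · simp only [hik, if_true]
        rw [compl_adj]
        rcases hq_cases i hik with ⟨hi, h⟩ | ⟨hi, h⟩ | ⟨hi, h⟩
        · rw [h, h1m.2]
          exact ⟨fun _ => Or.inl hi, fun _ => ⟨h1m.1, by omega⟩⟩
        · rw [h, h2m.2]
          exact ⟨fun h' => absurd rfl h'.2, fun h' => by omega⟩
        · have := hmW _ h
          exact ⟨fun h' => absurd this h'.2, fun h' => by omega⟩
      · simp only [hik, if_false]
        rw [compl_adj, h0m.2]
        exact ⟨fun _ => by omega, fun _ => ⟨h0m.1, by omega⟩⟩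

/-- In a graph with no long holes, `P₁(6)` or `P₂(6)`, a co-component of the common neighbours of
two non-adjacent vertices separates them, together with its other common neighbours. -/
theorem IsCoComponent.separatesIn {V : Type*} {K : SimpleGraph V}
    (hholes : ∀ n : ℕ, 5 ≤ n → IsEmpty (cycleGraph n ↪g K))
    (hP1 : IsEmpty (P16 ↪g K)) (hP2 : IsEmpty (P26 ↪g K)) {u v : V} (huv : u ≠ v)
    (hnadj : ¬ K.Adj u v) {W : Set V} (hW : IsCoComponent K (commonNbrs K {u, v}) W) :
    SeparatesIn K (W ∪ (commonNbrs K W \ {u, v})) u v := by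
  have hWu : ∀ w ∈ W, K.Adj w u := fun w hw => hW.subset hw u (by simp)
  have hWv : ∀ w ∈ W, K.Adj w v := fun w hw => hW.subset hw v (by simp)
  have huW : u ∉ W := fun h => K.irrefl (hWu u h)
  have hvW : v ∉ W := fun h => K.irrefl (hWv v h)
  refine ⟨by simp [huW], by simp [hvW], fun hr => ?_⟩
  obtain ⟨m, p, hp0, hpm, hpL, hp⟩ := exists_isInducedPathSeq hr
  dsimp only at hp0 hpm
  have hpW : ∀ i, p i ∉ W := fun i h => hpL i (Or.inl h)
  have hpC : ∀ i, 0 < i → i < m → p i ∉ commonNbrs K W := by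
    intro i hi him h
    refine hpL i (Or.inr ⟨h, ?_⟩)
    rintro (h' | h')
    · exact (hp 0 i hi him.le).1 (hp0.trans h'.symm)
    · exact (hp i m him le_rfl).1 (h'.trans hpm.symm)
  have hm : 3 ≤ m := by
    by_contra! hlt
    obtain rfl | rfl | rfl : m = 0 ∨ m = 1 ∨ m = 2 := by omega
    · exact huv (hp0.symm.trans hpm)
    · exact hnadj (hp0 ▸ hpm ▸ (hp 0 1 (by omega) le_rfl).2.2 rfl)
    · have h1 := (hp 0 1 (by omega) (by omega)).2.2 rfl
      have h2 := (hp 1 2 (by omega) le_rfl).2.2 rfl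
      rw [hp0] at h1
      rw [hpm] at h2
      have hmem : p 1 ∈ commonNbrs K {u, v} := by
        rintro s (rfl | rfl)
        · exact h1.symm
        · exact h2
      exact hpC 1 (by omega) (by omega) fun w hw => hW.adj hmem (hpW 1) hw
  exact (complete_one_or_complete_two hholes hP1 hP2 hW.preconnected hp hm hpW
    (hp0.symm ▸ hWu) (hpm.symm ▸ hWv)).elim (hpC 1 (by omega) (by omega))
    (hpC 2 (by omega) (by omega))

/-- Chudnovsky–Seymour style lemma: in a connected, co-connected graph with no long holes
and no induced `P₁(6)`, `P₂(6)`, every pair of vertices at distance 2 and every co-component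
`W` of their common neighbours yields one of three separation conclusions. -/
theorem skew_partition_lemma {V : Type*} [Fintype V] (K : SimpleGraph V)
    (hconn : K.Connected) (hcoconn : Kᶜ.Connected)
    (hholes : ∀ n : ℕ, 5 ≤ n → IsEmpty (SimpleGraph.cycleGraph n ↪g K))
    (hP1 : IsEmpty (P16 ↪g K)) (hP2 : IsEmpty (P26 ↪g K)) :
    ∀ u v : V, AtDistanceTwo K u v →
      ∀ W : Set V, IsCoComponent K (commonNbrs K {u, v}) W →
        ¬ (K.induce ({u} ∪ W)ᶜ).Connected ∨
        ¬ (K.induce ({v} ∪ W)ᶜ).Connected ∨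
        ((commonNbrs K W \ {u, v}).Nonempty ∧
          SeparatesIn K (W ∪ (commonNbrs K W \ {u, v})) u v) := by
  intro u v ⟨huv, hnadj, _⟩ W hW
  by_cases h1 : (K.induce ({u} ∪ W)ᶜ).Connected
  · by_cases h2 : (K.induce ({v} ∪ W)ᶜ).Connected
    · have hsep := hW.separatesIn hholes hP1 hP2 huv hnadj
      refine Or.inr (Or.inr ⟨Set.nonempty_iff_ne_empty.2 fun he => ?_, hsep⟩)
      rw [he, Set.union_empty] at hsep
      exact not_separatesIn_of_connected hcoconn hW.nonempty
        (fun w hw => hW.subset hw u (by simp)) (fun w hw => hW.subset hw v (by simp)) h1 h2 hsep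
    · exact Or.inr (Or.inl h2)
  · exact Or.inl h1
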